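/- arXiv:2006.04024 — 9 statements merged into one kernel-verified Lean document; each statement's English description precedes it below -/
import Mathlib

section
/- Suppose X̃^T X̃ is invertible and Z^T Z is invertible, where Z = (1_n X). Then the r-th diagonal element h_rr of the hat matrix H = Z (Z^T Z)^{-1} Z^T satisfies h_rr = (1/n)(1 + D_r^2), where D_r^2 = n (x_r − x̄)^T (X̃^T X̃)^{-1} (x_r − x̄) is the squared Mahalanobis distance from x_r to the data mean x̄ = (1/n) Σ_{j=1}^n x_j. -/
open Matrix

/-- The hat matrix of `Z` is the only symmetric matrix that factors through `Z` and fixes `Z`. -/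
theorem hat_matrix_eq_of_isSymm {m q : Type*} [Fintype m] [Fintype q] [DecidableEq q]
    {Z : Matrix m q ℝ} (hZ : IsUnit (Zᵀ * Z).det) {M : Matrix m m ℝ} (C : Matrix q m ℝ)
    (hC : M = Z * C) (hM : Mᵀ = M) (hMZ : M * Z = Z) :
    Z * (Zᵀ * Z)⁻¹ * Zᵀ = M := by
  have h : Zᵀ * M = Zᵀ := by
    rw [← hM, ← transpose_mul, hMZ]
  calc Z * (Zᵀ * Z)⁻¹ * Zᵀ = Z * (Zᵀ * Z)⁻¹ * (Zᵀ * M) := by rw [h]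
    _ = Z * ((Zᵀ * Z)⁻¹ * (Zᵀ * Z * C)) := by simp only [hC, Matrix.mul_assoc]
    _ = M := by rw [nonsing_inv_mul_cancel_left _ _ hZ, hC]

/-- The averaging matrix `(1/n) 1 1ᵀ` is idempotent. -/
theorem averaging_mul_self {n : ℕ} (hn : 0 < n) :
    ((n : ℝ)⁻¹ • Matrix.of (fun _ _ : Fin n => (1 : ℝ))) *
      ((n : ℝ)⁻¹ • Matrix.of (fun _ _ : Fin n => (1 : ℝ))) =
      (n : ℝ)⁻¹ • Matrix.of (fun _ _ : Fin n => (1 : ℝ)) := by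
  have hn' : (n : ℝ) ≠ 0 := by positivity
  ext i j
  simp [Matrix.mul_apply, hn']

/-- The r-th diagonal element of the hat matrix satisfies
`h_rr = (1/n)(1 + D_r²)` where `D_r² = n (x_r - x̄)ᵀ (X̃ᵀ X̃)⁻¹ (x_r - x̄)` is the squared
Mahalanobis distance of `x_r` from the data mean `x̄`. -/
theorem leverage_eq_one_plus_mahalanobis (n p : ℕ) (hn : 0 < n)
    (X : Matrix (Fin n) (Fin p) ℝ)
    (Z : Matrix (Fin n) (Fin (p + 1)) ℝ)
    (hZ : Z = Matrix.of fun i j => Fin.cases (motive := fun _ => ℝ) 1 (fun k => X i k) j)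
    (Xt : Matrix (Fin n) (Fin p) ℝ)
    (hXt : Xt = (1 - (n : ℝ)⁻¹ • Matrix.of (fun _ _ => (1 : ℝ))) * X)
    (hZZ : IsUnit (Zᵀ * Z).det)
    (hXX : IsUnit (Xtᵀ * Xt).det)
    (r : Fin n)
    (xbar : Fin p → ℝ) (hxbar : xbar = fun j => (n : ℝ)⁻¹ * ∑ i, X i j)
    (D2 : ℝ)
    (hD2 : D2 = (n : ℝ) *
      ((fun j => X r j - xbar j) ⬝ᵥ ((Xtᵀ * Xt)⁻¹ *ᵥ (fun j => X r j - xbar j)))) :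
    (Z * (Zᵀ * Z)⁻¹ * Zᵀ) r r = (n : ℝ)⁻¹ * (1 + D2) := by
  have hn' : (n : ℝ) ≠ 0 := by positivity
  have hcc := averaging_mul_self hn
  set c : Matrix (Fin n) (Fin n) ℝ := (n : ℝ)⁻¹ • Matrix.of (fun _ _ => (1 : ℝ)) with hc
  have hct : cᵀ = c := by ext i j; simp [hc]
  have hcX : ∀ i j, (c * X) i j = xbar j := by
    intro i j
    simp [hc, hxbar, Matrix.mul_apply, Finset.mul_sum]
  have hXt' : Xt = X - c * X := by
    have h : Xt = ((1 : Matrix (Fin n) (Fin n) ℝ) - c) * X := hXt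
    rw [h, Matrix.sub_mul, Matrix.one_mul]
  have hcXt : c * Xt = 0 := by
    rw [hXt', Matrix.mul_sub, ← Matrix.mul_assoc, hcc, sub_self]
  have hXtc : Xtᵀ * c = 0 := by
    rw [← hct, ← transpose_mul, hcXt, transpose_zero]
  let P : Matrix (Fin p) (Fin (p + 1)) ℝ := Matrix.of fun k j => if j = k.succ then 1 else 0
  let E : Matrix (Fin (p + 1)) (Fin n) ℝ := Matrix.of fun j _ => if j = 0 then (n : ℝ)⁻¹ else 0
  have hZE : c = Z * E := by
    ext i j
    simp [hc, hZ, E, Matrix.mul_apply]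
  have hZP : X = Z * Pᵀ := by
    ext i j
    simp [hZ, P, Matrix.mul_apply]
  have hZdecomp : Z = c * Z + Xt * P := by
    ext i j
    rw [Matrix.add_apply]
    refine Fin.cases ?_ (fun k => ?_) j
    · simp [hc, hZ, P, Matrix.mul_apply, hn', (Fin.succ_ne_zero _).symm]
    · have h1 : (c * Z) i k.succ = (c * X) i k := by simp [hZ, Matrix.mul_apply]
      have h2 : (Xt * P) i k.succ = Xt i k := by simp [P, Matrix.mul_apply]
      rw [h1, h2, hXt', Matrix.sub_apply]
      simp [hZ]
  have hhat : Z * (Zᵀ * Z)⁻¹ * Zᵀ = c + Xt * (Xtᵀ * Xt)⁻¹ * Xtᵀ := by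
    refine hat_matrix_eq_of_isSymm hZZ
      (E + (Pᵀ - E * X) * (Xtᵀ * Xt)⁻¹ * Xtᵀ) ?_ ?_ ?_
    · have h : Xt = Z * (Pᵀ - E * X) := by
        rw [Matrix.mul_sub, ← hZP, ← Matrix.mul_assoc, ← hZE, hXt']
      rw [Matrix.mul_add, ← hZE, ← Matrix.mul_assoc, ← Matrix.mul_assoc, ← h]
    · simp only [transpose_add, transpose_mul, transpose_transpose, transpose_nonsing_inv, hct,
        Matrix.mul_assoc]
    · have h : Xtᵀ * Z = Xtᵀ * Xt * P := by
        rw [hZdecomp, Matrix.mul_add, ← Matrix.mul_assoc, hXtc, Matrix.zero_mul, zero_add,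
          Matrix.mul_assoc]
      rw [Matrix.add_mul, Matrix.mul_assoc _ Xtᵀ Z, h, Matrix.mul_assoc Xt,
        nonsing_inv_mul_cancel_left _ _ hXX, ← hZdecomp]
  have hrow : (fun j => X r j - xbar j) = Xt r := by
    ext j
    rw [hXt', Matrix.sub_apply, hcX]
  have hquad : (Xt * (Xtᵀ * Xt)⁻¹ * Xtᵀ) r r = Xt r ⬝ᵥ ((Xtᵀ * Xt)⁻¹ *ᵥ Xt r) := by
    rw [Matrix.mul_assoc]
    rfl
  rw [hhat, Matrix.add_apply, hquad, hD2, hrow, mul_add, inv_mul_cancel_left₀ hn']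
  simp [hc]
end

section
/- Partition X̃ = (X̃_1 x̃_p), where X̃_1 consists of the first p−1 columns of X̃ and x̃_p is its last column, and partition A with leading principal submatrix A_1 of order p−1, last row (a_1^T, a_pp), and zero block above a_pp. If X̃_1^T X̃_1 is invertible, then the least squares coefficient vector for the regression of x̃_p on the other (centered) regressors satisfies (X̃_1^T X̃_1)^{-1} X̃_1^T x̃_p = (A_1 A_1^T)^{-1} A_1 a_1 = −(1/b_pp) (b_{1p}, …, b_{p−1,p})^T, where b = (b_{1p}, …, b_{pp})^T is the last column of B. -/
open Matrix

/-- If `A` is lower triangular, cross products of the rows above the last one only involve the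
columns before the last one. -/
theorem mul_transpose_apply_castSucc_of_lower {m : ℕ} {A : Matrix (Fin (m + 1)) (Fin (m + 1)) ℝ}
    (hAlow : ∀ i j : Fin (m + 1), i < j → A i j = 0) (i : Fin m) (k : Fin (m + 1)) :
    (A * Aᵀ) i.castSucc k = ∑ j : Fin m, A i.castSucc j.castSucc * A k j.castSucc := by
  simp [Matrix.mul_apply, Fin.sum_univ_castSucc, hAlow _ _ (Fin.castSucc_lt_last i)]

theorem regression_coefficients_of_castSucc {n m : ℕ} (hn : 0 < n)
    (Y : Matrix (Fin n) (Fin (m + 1)) ℝ) (A B : Matrix (Fin (m + 1)) (Fin (m + 1)) ℝ)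
    (hAlow : ∀ i j : Fin (m + 1), i < j → A i j = 0) (hAdiag : ∀ i, 0 < A i i)
    (hA : (n : ℝ)⁻¹ • (Yᵀ * Y) = A * Aᵀ) (hB : Bᵀ = A⁻¹)
    (Y1 : Matrix (Fin n) (Fin m) ℝ) (hY1 : Y1 = Y.submatrix id Fin.castSucc)
    (yp : Fin n → ℝ) (hyp : yp = fun i => Y i (Fin.last m))
    (hdet : IsUnit (Y1ᵀ * Y1).det)
    (A1 : Matrix (Fin m) (Fin m) ℝ) (hA1 : A1 = A.submatrix Fin.castSucc Fin.castSucc)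
    (a1 : Fin m → ℝ) (ha1 : a1 = fun j => A (Fin.last m) j.castSucc)
    (b1 : Fin m → ℝ) (hb1 : b1 = fun j => B j.castSucc (Fin.last m)) :
    (Y1ᵀ * Y1)⁻¹ *ᵥ (Y1ᵀ *ᵥ yp) = (A1 * A1ᵀ)⁻¹ *ᵥ (A1 *ᵥ a1) ∧
      (A1 * A1ᵀ)⁻¹ *ᵥ (A1 *ᵥ a1) = (-(1 / B (Fin.last m) (Fin.last m))) • b1 := by
  have hn0 : (n : ℝ) ≠ 0 := by positivity
  have hA_unit : IsUnit A.det := by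
    rw [Matrix.det_of_isLowerTriangular A (fun i j hij => hAlow i j hij)]
    exact (Finset.prod_pos fun i _ => hAdiag i).ne'.isUnit
  have hAB : Aᵀ * B = 1 := by
    rw [← Matrix.transpose_transpose B, hB, ← Matrix.transpose_mul,
      Matrix.nonsing_inv_mul A hA_unit, Matrix.transpose_one]
  have gram : A1 * A1ᵀ = (n : ℝ)⁻¹ • (Y1ᵀ * Y1) := by
    ext i j
    have h := congrFun₂ hA i.castSucc j.castSucc
    rw [mul_transpose_apply_castSucc_of_lower hAlow] at h
    simpa [hA1, hY1, Matrix.mul_apply] using h.symm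
  have cross : A1 *ᵥ a1 = (n : ℝ)⁻¹ • (Y1ᵀ *ᵥ yp) := by
    ext i
    have h := congrFun₂ hA i.castSucc (Fin.last m)
    rw [mul_transpose_apply_castSucc_of_lower hAlow] at h
    simpa [hA1, ha1, hY1, hyp, Matrix.mul_apply, Matrix.mulVec, dotProduct] using h.symm
  have gram_unit : IsUnit (A1 * A1ᵀ).det := by
    rw [gram, Matrix.det_smul]
    exact (((inv_ne_zero hn0).isUnit).pow _).mul hdet
  have hbpp : B (Fin.last m) (Fin.last m) ≠ 0 := by
    intro h0
    have h := congrFun₂ hAB (Fin.last m) (Fin.last m)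
    simp [Matrix.mul_apply, Fin.sum_univ_castSucc, hAlow _ _ (Fin.castSucc_lt_last _), h0] at h
  have col : A1ᵀ *ᵥ b1 = (-B (Fin.last m) (Fin.last m)) • a1 := by
    ext i
    have h := congrFun₂ hAB i.castSucc (Fin.last m)
    rw [Matrix.mul_apply, Fin.sum_univ_castSucc,
      Matrix.one_apply_ne (Fin.castSucc_lt_last i).ne] at h
    simp only [hA1, ha1, hb1, Matrix.mulVec, dotProduct, Matrix.transpose_apply,
      Matrix.submatrix_apply, Pi.smul_apply, smul_eq_mul] at h ⊢
    linarith
  have cancel (x : Fin m → ℝ) : (A1 * A1ᵀ)⁻¹ *ᵥ ((A1 * A1ᵀ) *ᵥ x) = x := by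
    rw [Matrix.mulVec_mulVec, Matrix.nonsing_inv_mul _ gram_unit, Matrix.one_mulVec]
  constructor
  · have h : (A1 * A1ᵀ) *ᵥ ((Y1ᵀ * Y1)⁻¹ *ᵥ (Y1ᵀ *ᵥ yp)) = A1 *ᵥ a1 := by
      rw [gram, cross, Matrix.smul_mulVec, Matrix.mulVec_mulVec,
        Matrix.mul_nonsing_inv _ hdet, Matrix.one_mulVec]
    rw [← h, cancel]
  · have h : (A1 * A1ᵀ) *ᵥ ((-(1 / B (Fin.last m) (Fin.last m))) • b1) = A1 *ᵥ a1 := by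
      rw [Matrix.mulVec_smul, ← Matrix.mulVec_mulVec, col, Matrix.mulVec_smul, smul_smul,
        neg_mul_neg, one_div_mul_cancel hbpp, one_smul]
    rw [← h, cancel]

/-- With `X̃ = (X̃₁ x̃ₚ)` and the Cholesky root `A` of the data covariance
matrix partitioned with leading principal submatrix `A₁`, last row `(a₁ᵀ, aₚₚ)`,
the least squares coefficient vector of the regression of `x̃ₚ` on the other centered
regressors satisfies
`(X̃₁ᵀ X̃₁)⁻¹ X̃₁ᵀ x̃ₚ = (A₁ A₁ᵀ)⁻¹ A₁ a₁ = -(1/bₚₚ)(b₁ₚ, …, b_{p-1,p})ᵀ`. -/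
theorem regression_coefficients_via_cholesky (n p : ℕ) (hn : 0 < n) (hp : 2 ≤ p)
    (X : Matrix (Fin n) (Fin p) ℝ)
    (Xt : Matrix (Fin n) (Fin p) ℝ)
    (hXt : Xt = (1 - (n : ℝ)⁻¹ • Matrix.of (fun _ _ => (1 : ℝ))) * X)
    (hSpd : ((n : ℝ)⁻¹ • (Xtᵀ * Xt)).PosDef)
    (A : Matrix (Fin p) (Fin p) ℝ)
    (hAlow : ∀ i j : Fin p, i < j → A i j = 0)
    (hAdiag : ∀ i, 0 < A i i)
    (hA : (n : ℝ)⁻¹ • (Xtᵀ * Xt) = A * Aᵀ)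
    (B : Matrix (Fin p) (Fin p) ℝ)
    (hB : Bᵀ = A⁻¹)
    (lastIdx : Fin p) (hlast : (lastIdx : ℕ) = p - 1)
    (X1 : Matrix (Fin n) (Fin (p - 1)) ℝ)
    (hX1 : X1 = Xt.submatrix id (Fin.castLE (Nat.sub_le p 1)))
    (xp : Fin n → ℝ) (hxp : xp = fun i => Xt i lastIdx)
    (hX1X1 : IsUnit (X1ᵀ * X1).det)
    (A1 : Matrix (Fin (p - 1)) (Fin (p - 1)) ℝ)
    (hA1 : A1 = A.submatrix (Fin.castLE (Nat.sub_le p 1)) (Fin.castLE (Nat.sub_le p 1)))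
    (a1 : Fin (p - 1) → ℝ) (ha1 : a1 = fun j => A lastIdx (Fin.castLE (Nat.sub_le p 1) j))
    (b1 : Fin (p - 1) → ℝ) (hb1 : b1 = fun j => B (Fin.castLE (Nat.sub_le p 1) j) lastIdx) :
    (X1ᵀ * X1)⁻¹ *ᵥ (X1ᵀ *ᵥ xp) = (A1 * A1ᵀ)⁻¹ *ᵥ (A1 *ᵥ a1) ∧
      (A1 * A1ᵀ)⁻¹ *ᵥ (A1 *ᵥ a1) = (-(1 / B lastIdx lastIdx)) • b1 := by
  obtain ⟨m, rfl⟩ : ∃ m, p = m + 1 := ⟨p - 1, by omega⟩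
  obtain rfl : lastIdx = Fin.last m := Fin.ext (by simpa using hlast)
  exact regression_coefficients_of_castSucc hn Xt A B hAlow hAdiag hA hB X1 hX1 xp hxp hX1X1
    A1 hA1 a1 ha1 b1 hb1
end

section
/- Partition X̃ = (X̃_1 x̃_p) into its first p−1 columns and its last column, and assume X̃_1^T X̃_1 is invertible. Then the r-th residual from the least squares regression of x̃_p on X̃_1, namely the r-th entry of x̃_p − X̃_1 (X̃_1^T X̃_1)^{-1} X̃_1^T x̃_p, equals (1/b_pp) b^T (x_r − x̄), where b = (b_{1p}, …, b_{pp})^T is the last column of B, x_r is the r-th row of X, and x̄ is the vector of column means of X. -/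
open Matrix

/-- If `X *ᵥ β + c • y` is orthogonal to the columns of `X` and `c ≠ 0`, then it is `c` times the
least squares residual of `y` on `X`. -/
theorem residual_eq_of_orthogonal {n m : Type*} [Fintype n] [Fintype m] [DecidableEq m]
    (X : Matrix n m ℝ) (y : n → ℝ) (hX : IsUnit (Xᵀ * X).det) (β : m → ℝ) (c : ℝ) (hc : c ≠ 0)
    (h : Xᵀ *ᵥ (X *ᵥ β + c • y) = 0) :
    y - X *ᵥ ((Xᵀ * X)⁻¹ *ᵥ (Xᵀ *ᵥ y)) = c⁻¹ • (X *ᵥ β + c • y) := by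
  have hy : Xᵀ *ᵥ y = (Xᵀ * X) *ᵥ (-(c⁻¹ • β)) := by
    rw [mulVec_add, mulVec_smul, mulVec_mulVec] at h
    rw [mulVec_neg, mulVec_smul, eq_neg_of_add_eq_zero_left h, smul_neg, neg_neg,
      inv_smul_smul₀ hc]
  rw [hy, mulVec_mulVec _ (Xᵀ * X)⁻¹, nonsing_inv_mul _ hX, one_mulVec, mulVec_neg, mulVec_smul, smul_add,
    inv_smul_smul₀ hc, sub_neg_eq_add, add_comm]

/-- The r-th residual from the least squares regression of `x̃ₚ` on `X̃₁`
equals `(1/bₚₚ) bᵀ (x_r - x̄)` where `b` is the last column of `B`. -/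
theorem residual_via_cholesky (n p : ℕ) (hn : 0 < n) (hp : 2 ≤ p)
    (X : Matrix (Fin n) (Fin p) ℝ)
    (Xt : Matrix (Fin n) (Fin p) ℝ)
    (hXt : Xt = (1 - (n : ℝ)⁻¹ • Matrix.of (fun _ _ => (1 : ℝ))) * X)
    (hSpd : ((n : ℝ)⁻¹ • (Xtᵀ * Xt)).PosDef)
    (A : Matrix (Fin p) (Fin p) ℝ)
    (hAlow : ∀ i j : Fin p, i < j → A i j = 0)
    (hAdiag : ∀ i, 0 < A i i)
    (hA : (n : ℝ)⁻¹ • (Xtᵀ * Xt) = A * Aᵀ)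
    (B : Matrix (Fin p) (Fin p) ℝ)
    (hB : Bᵀ = A⁻¹)
    (lastIdx : Fin p) (hlast : (lastIdx : ℕ) = p - 1)
    (X1 : Matrix (Fin n) (Fin (p - 1)) ℝ)
    (hX1 : X1 = Xt.submatrix id (Fin.castLE (Nat.sub_le p 1)))
    (xp : Fin n → ℝ) (hxp : xp = fun i => Xt i lastIdx)
    (hX1X1 : IsUnit (X1ᵀ * X1).det)
    (xbar : Fin p → ℝ) (hxbar : xbar = fun j => (n : ℝ)⁻¹ * ∑ i, X i j)
    (b : Fin p → ℝ) (hb : b = fun k => B k lastIdx)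
    (r : Fin n) :
    (xp - X1 *ᵥ ((X1ᵀ * X1)⁻¹ *ᵥ (X1ᵀ *ᵥ xp))) r =
      (1 / B lastIdx lastIdx) * (b ⬝ᵥ (fun j => X r j - xbar j)) := by
  obtain ⟨m, rfl⟩ : ∃ m, p = m + 1 := ⟨p - 1, by omega⟩
  obtain rfl : lastIdx = Fin.last m := Fin.ext (by simpa using hlast)
  have hn0 : (n : ℝ) ≠ 0 := by positivity
  have hAunit : IsUnit A.det := by
    have hdet : A.det = ∏ i, A i i := det_of_isLowerTriangular A fun i j hij => hAlow i j hij
    rw [hdet]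
    exact (Finset.prod_pos fun i _ => hAdiag i).ne'.isUnit
  have hAb : Aᵀ *ᵥ b = Pi.single (Fin.last m) 1 := by
    have hBA : Aᵀ * B = 1 := by
      rw [← transpose_inj, transpose_mul, transpose_transpose, hB, nonsing_inv_mul _ hAunit,
        transpose_one]
    have hbcol : b = B *ᵥ Pi.single (Fin.last m) 1 := by
      rw [mulVec_single_one, hb]; rfl
    rw [hbcol, mulVec_mulVec, hBA, one_mulVec]
  have hc : B (Fin.last m) (Fin.last m) ≠ 0 := by
    intro h0
    have h := congrFun hAb (Fin.last m)
    rw [mulVec, dotProduct, Fin.sum_univ_castSucc] at h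
    simp [hAlow _ _ (Fin.castSucc_lt_last _), hb, h0] at h
  have hXtb : Xt *ᵥ b = X1 *ᵥ (fun k => b k.castSucc) + B (Fin.last m) (Fin.last m) • xp := by
    ext i
    simp only [mulVec, dotProduct, Pi.add_apply, Pi.smul_apply, smul_eq_mul, hxp, hX1]
    rw [Fin.sum_univ_castSucc, mul_comm (B _ _), hb]
    rfl
  have hnormal : Xtᵀ *ᵥ (Xt *ᵥ b) = (n : ℝ) • fun k => A k (Fin.last m) := by
    rw [mulVec_mulVec, ← smul_inv_smul₀ hn0 (Xtᵀ * Xt), hA, smul_mulVec, ← mulVec_mulVec, hAb,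
      mulVec_single_one]
    rfl
  have horth : X1ᵀ *ᵥ (Xt *ᵥ b) = 0 := by
    ext k
    have h := congrFun hnormal (Fin.castSucc (n := m) k)
    rw [Pi.smul_apply, hAlow _ _ (Fin.castSucc_lt_last (n := m) k), smul_zero] at h
    rw [hX1]
    exact h
  have hrow : ∀ j, Xt r j = X r j - xbar j := by
    intro j
    have hcenter :
        Xt = X - (n : ℝ)⁻¹ • ((Matrix.of fun _ _ => 1 : Matrix (Fin n) (Fin n) ℝ) * X) := by
      rw [← Matrix.smul_mul]
      nth_rewrite 1 [← Matrix.one_mul X]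
      rw [← Matrix.sub_mul]
      exact hXt
    simp [hcenter, hxbar, Matrix.mul_apply]
  rw [residual_eq_of_orthogonal X1 xp hX1X1 _ _ hc (hXtb ▸ horth), ← hXtb, Pi.smul_apply,
    smul_eq_mul, one_div, mulVec, dotProduct_comm]
  simp only [← hrow]
end

section
/- Partition X̃ = (X̃_1 x̃_p) into its first p−1 columns and its last column, and assume X̃_1^T X̃_1 is invertible. Then the error sum of squares of the least squares regression of x̃_p on X̃_1, namely SSE = ‖x̃_p − X̃_1 (X̃_1^T X̃_1)^{-1} X̃_1^T x̃_p‖², equals n / b_pp², where b_pp is the (p,p) entry of B. -/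
open Matrix

/-- The last entry of `c ᵥ* A` for a lower triangular matrix `A`. -/
lemma lowerTriangular_vecMul_last {k : ℕ} (A : Matrix (Fin (k + 1)) (Fin (k + 1)) ℝ)
    (hlow : ∀ i j, i < j → A i j = 0) (c : Fin (k + 1) → ℝ) :
    (c ᵥ* A) (Fin.last k) = c (Fin.last k) * A (Fin.last k) (Fin.last k) := by
  simp only [vecMul, dotProduct]
  refine Finset.sum_eq_single _ (fun i _ hi => ?_) (by simp)
  rw [hlow i _ (Fin.lt_last_iff_ne_last.2 hi), mul_zero]

/-- If `c` has last entry `1` and `A Aᵀ c` is `s` times the last basis vector, for `A` lower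
triangular and invertible, then `s` times the squared last diagonal entry of `A⁻¹` is `1`. -/
lemma mul_inv_last_sq_eq_one {k : ℕ} (A : Matrix (Fin (k + 1)) (Fin (k + 1)) ℝ)
    (hlow : ∀ i j, i < j → A i j = 0) (hdet : IsUnit A.det) (c : Fin (k + 1) → ℝ)
    (hc : c (Fin.last k) = 1) (s : ℝ) (h : A *ᵥ (Aᵀ *ᵥ c) = Pi.single (Fin.last k) s) :
    s * (A⁻¹ (Fin.last k) (Fin.last k)) ^ 2 = 1 := by
  have hinv : A⁻¹ (Fin.last k) (Fin.last k) * A (Fin.last k) (Fin.last k) = 1 := by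
    have h1 := lowerTriangular_vecMul_last A hlow (A⁻¹ (Fin.last k))
    rw [← h1]
    have h2 := congrFun (congrFun (nonsing_inv_mul A hdet) (Fin.last k)) (Fin.last k)
    rwa [one_apply_eq] at h2
  have hs : A⁻¹ (Fin.last k) (Fin.last k) * s = A (Fin.last k) (Fin.last k) := by
    have h1 : Aᵀ *ᵥ c = A⁻¹ *ᵥ Pi.single (Fin.last k) s := by
      rw [← h, mulVec_mulVec, nonsing_inv_mul A hdet, one_mulVec]
    have h2 := congrFun h1 (Fin.last k)
    rw [mulVec_transpose, lowerTriangular_vecMul_last A hlow, hc, one_mul] at h2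
    simpa [mulVec, dotProduct_single] using h2.symm
  linear_combination A⁻¹ (Fin.last k) (Fin.last k) * hs + hinv

/-- The least squares residual is orthogonal to the regressors. -/
lemma transpose_mulVec_residual {m k : Type*} [Fintype m] [Fintype k] [DecidableEq k]
    (X : Matrix m k ℝ) (y : m → ℝ) (h : IsUnit (Xᵀ * X).det) :
    Xᵀ *ᵥ (y - X *ᵥ ((Xᵀ * X)⁻¹ *ᵥ (Xᵀ *ᵥ y))) = 0 := by
  rw [mulVec_sub, mulVec_mulVec _ Xᵀ X, mulVec_mulVec _ (Xᵀ * X), mul_nonsing_inv _ h,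
    one_mulVec, sub_self]

/-- The error sum of squares of the least squares regression of `x̃ₚ` on
`X̃₁`, `SSE = ‖x̃ₚ - X̃₁ (X̃₁ᵀ X̃₁)⁻¹ X̃₁ᵀ x̃ₚ‖²`, equals `n / bₚₚ²`. -/
theorem sse_via_cholesky (n p : ℕ) (hn : 0 < n) (hp : 2 ≤ p)
    (X : Matrix (Fin n) (Fin p) ℝ)
    (Xt : Matrix (Fin n) (Fin p) ℝ)
    (hXt : Xt = (1 - (n : ℝ)⁻¹ • Matrix.of (fun _ _ => (1 : ℝ))) * X)
    (hSpd : ((n : ℝ)⁻¹ • (Xtᵀ * Xt)).PosDef)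
    (A : Matrix (Fin p) (Fin p) ℝ)
    (hAlow : ∀ i j : Fin p, i < j → A i j = 0)
    (hAdiag : ∀ i, 0 < A i i)
    (hA : (n : ℝ)⁻¹ • (Xtᵀ * Xt) = A * Aᵀ)
    (B : Matrix (Fin p) (Fin p) ℝ)
    (hB : Bᵀ = A⁻¹)
    (lastIdx : Fin p) (hlast : (lastIdx : ℕ) = p - 1)
    (X1 : Matrix (Fin n) (Fin (p - 1)) ℝ)
    (hX1 : X1 = Xt.submatrix id (Fin.castLE (Nat.sub_le p 1)))
    (xp : Fin n → ℝ) (hxp : xp = fun i => Xt i lastIdx)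
    (hX1X1 : IsUnit (X1ᵀ * X1).det) :
    ∑ r, ((xp - X1 *ᵥ ((X1ᵀ * X1)⁻¹ *ᵥ (X1ᵀ *ᵥ xp))) r) ^ 2 =
      (n : ℝ) / (B lastIdx lastIdx) ^ 2 := by
  obtain ⟨k, rfl⟩ : ∃ k, p = k + 1 := ⟨p - 1, by omega⟩
  obtain rfl : lastIdx = Fin.last k := Fin.ext (by simpa using hlast)
  change Matrix (Fin n) (Fin k) ℝ at X1
  have hn' : (n : ℝ) ≠ 0 := by positivity
  have hdet : IsUnit A.det := by
    have h := hSpd.det_pos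
    rw [hA, det_mul, det_transpose] at h
    exact isUnit_iff_ne_zero.2 fun h0 => by simp [h0] at h
  have hcol : ∀ i j, Xt i (Fin.castSucc j) = X1 i j := fun i j => by rw [hX1]; rfl
  have horth := transpose_mulVec_residual X1 xp hX1X1
  set β : Fin k → ℝ := (X1ᵀ * X1)⁻¹ *ᵥ (X1ᵀ *ᵥ xp)
  set r : Fin n → ℝ := xp - X1 *ᵥ β with hr
  let c : Fin (k + 1) → ℝ := Fin.snoc (-β) 1
  have hXc : Xt *ᵥ c = r := by
    ext i
    simp only [mulVec, dotProduct, Fin.sum_univ_castSucc, c, Fin.snoc_castSucc, Fin.snoc_last,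
      hcol, hr, hxp, Pi.sub_apply, Pi.neg_apply, mul_neg, Finset.sum_neg_distrib]
    ring
  have hxr : xp ⬝ᵥ r = ∑ i, r i ^ 2 := by
    have h1 : (X1 *ᵥ β) ⬝ᵥ r = 0 := by
      rw [dotProduct_comm, dotProduct_mulVec, ← mulVec_transpose, horth, zero_dotProduct]
    have h2 : r ⬝ᵥ r = xp ⬝ᵥ r := by
      nth_rewrite 1 [hr]
      rw [sub_dotProduct, h1, sub_zero]
    rw [← h2]
    simp only [dotProduct, sq]
  have hXr : Xtᵀ *ᵥ r = Pi.single (Fin.last k) (∑ i, r i ^ 2) := by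
    ext j
    refine Fin.lastCases ?_ (fun j => ?_) j
    · rw [Pi.single_eq_same, ← hxr, hxp]
      rfl
    · rw [Pi.single_eq_of_ne (Fin.castSucc_lt_last j).ne]
      have h := congrFun horth j
      simpa only [mulVec, dotProduct, transpose_apply, hcol, Pi.zero_apply] using h
  have hAc : A *ᵥ (Aᵀ *ᵥ c) = Pi.single (Fin.last k) ((n : ℝ)⁻¹ * ∑ i, r i ^ 2) := by
    rw [mulVec_mulVec, ← hA, smul_mulVec, ← mulVec_mulVec, hXc, hXr, ← Pi.single_smul,
      smul_eq_mul]
  have key := mul_inv_last_sq_eq_one A hAlow hdet c (by simp [c]) _ hAc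
  rw [← hB, transpose_apply] at key
  have hb : B (Fin.last k) (Fin.last k) ^ 2 ≠ 0 := right_ne_zero_of_mul_eq_one key
  rw [eq_div_iff hb]
  field_simp at key
  linarith
end

section
/- Partition X̃ = (X̃_1 x̃_p) into its first p−1 columns and its last column, and partition A with leading principal submatrix A_1 of order p−1 and last row (a_1^T, a_pp). If X̃_1^T X̃_1 is invertible, then the squared multiple correlation coefficient of the p-th regressor with the remaining regressors, r_p² = (x̃_p^T X̃_1 (X̃_1^T X̃_1)^{-1} X̃_1^T x̃_p) / (x̃_p^T x̃_p), satisfies r_p² = (a_1^T a_1) / (a_1^T a_1 + a_pp²). -/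
open Matrix

/-- If `MᵀM = c L Lᵀ` and `Mᵀ y = c L a` with `MᵀM` invertible, then the squared length of the
projection of `y` onto the column space of `M` is `c aᵀ a`. -/
theorem dotProduct_projection_eq_of_gram_factorization {m k : Type*} [Fintype m] [Fintype k]
    [DecidableEq k] {M : Matrix m k ℝ} {L : Matrix k k ℝ} {y : m → ℝ} {a : k → ℝ} {c : ℝ}
    (hM : Mᵀ * M = c • (L * Lᵀ)) (hy : Mᵀ *ᵥ y = c • (L *ᵥ a)) (hdet : IsUnit (Mᵀ * M).det) :
    y ⬝ᵥ (M *ᵥ ((Mᵀ * M)⁻¹ *ᵥ (Mᵀ *ᵥ y))) = c * (a ⬝ᵥ a) := by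
  have hL : IsUnit (Lᵀ).det := by
    rw [hM, det_smul, det_mul] at hdet
    exact isUnit_of_mul_isUnit_right (isUnit_of_mul_isUnit_right hdet)
  obtain ⟨w, hw⟩ : ∃ w, Lᵀ *ᵥ w = a :=
    ⟨(Lᵀ)⁻¹ *ᵥ a, by rw [mulVec_mulVec, mul_nonsing_inv _ hL, one_mulVec]⟩
  have hMw : Mᵀ *ᵥ y = (Mᵀ * M) *ᵥ w := by
    rw [hy, hM, smul_mulVec, ← mulVec_mulVec, hw]
  have hsolve : (Mᵀ * M)⁻¹ *ᵥ (Mᵀ *ᵥ y) = w := by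
    rw [hMw, mulVec_mulVec, nonsing_inv_mul _ hdet, one_mulVec]
  rw [hsolve, dotProduct_mulVec, ← mulVec_transpose, hy, smul_dotProduct, smul_eq_mul,
    ← vecMul_transpose, ← dotProduct_mulVec, hw]

/-- The squared multiple correlation coefficient of the p-th regressor with
the remaining regressors satisfies `r_p² = a₁ᵀ a₁ / (a₁ᵀ a₁ + aₚₚ²)`. -/
theorem multiple_correlation_via_cholesky (n p : ℕ) (hn : 0 < n) (hp : 2 ≤ p)
    (X : Matrix (Fin n) (Fin p) ℝ)
    (Xt : Matrix (Fin n) (Fin p) ℝ)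
    (hXt : Xt = (1 - (n : ℝ)⁻¹ • Matrix.of (fun _ _ => (1 : ℝ))) * X)
    (hSpd : ((n : ℝ)⁻¹ • (Xtᵀ * Xt)).PosDef)
    (A : Matrix (Fin p) (Fin p) ℝ)
    (hAlow : ∀ i j : Fin p, i < j → A i j = 0)
    (hAdiag : ∀ i, 0 < A i i)
    (hA : (n : ℝ)⁻¹ • (Xtᵀ * Xt) = A * Aᵀ)
    (lastIdx : Fin p) (hlast : (lastIdx : ℕ) = p - 1)
    (X1 : Matrix (Fin n) (Fin (p - 1)) ℝ)
    (hX1 : X1 = Xt.submatrix id (Fin.castLE (Nat.sub_le p 1)))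
    (xp : Fin n → ℝ) (hxp : xp = fun i => Xt i lastIdx)
    (hX1X1 : IsUnit (X1ᵀ * X1).det)
    (a1 : Fin (p - 1) → ℝ) (ha1 : a1 = fun j => A lastIdx (Fin.castLE (Nat.sub_le p 1) j))
    (rp2 : ℝ)
    (hrp2 : rp2 = (xp ⬝ᵥ (X1 *ᵥ ((X1ᵀ * X1)⁻¹ *ᵥ (X1ᵀ *ᵥ xp)))) / (xp ⬝ᵥ xp)) :
    rp2 = (a1 ⬝ᵥ a1) / (a1 ⬝ᵥ a1 + (A lastIdx lastIdx) ^ 2) := by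
  obtain ⟨q, rfl⟩ : ∃ q, p = q + 1 := ⟨p - 1, by omega⟩
  obtain rfl : lastIdx = Fin.last q := Fin.ext hlast
  have hn0 : (n : ℝ) ≠ 0 := by positivity
  have hgram : Xtᵀ * Xt = (n : ℝ) • (A * Aᵀ) := by
    rw [← hA, smul_smul, mul_inv_cancel₀ hn0, one_smul]
  have hentry (i j : Fin (q + 1)) : ∑ k, Xt k i * Xt k j = n * ∑ k, A i k * A j k := by
    simpa [mul_apply] using congrFun (congrFun hgram i) j
  have hlow (i : Fin q) : A i.castSucc (Fin.last q) = 0 := hAlow _ _ i.castSucc_lt_last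
  have hM : X1ᵀ * X1 = (n : ℝ) •
      (A.submatrix Fin.castSucc Fin.castSucc * (A.submatrix Fin.castSucc Fin.castSucc)ᵀ) := by
    ext i j
    have h := hentry (Fin.castSucc i) (Fin.castSucc j)
    rw [Fin.sum_univ_castSucc (fun k => A _ k * A _ k), hlow, zero_mul, add_zero] at h
    subst hX1
    exact h
  have hy : X1ᵀ *ᵥ xp = (n : ℝ) • (A.submatrix Fin.castSucc Fin.castSucc *ᵥ a1) := by
    ext i
    have h := hentry (Fin.castSucc i) (Fin.last q)
    rw [Fin.sum_univ_castSucc (fun k => A _ k * A _ k), hlow, zero_mul, add_zero] at h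
    subst hX1 hxp ha1
    exact h
  have hxx : xp ⬝ᵥ xp = n * (a1 ⬝ᵥ a1 + A (Fin.last q) (Fin.last q) ^ 2) := by
    have h := hentry (Fin.last q) (Fin.last q)
    rw [Fin.sum_univ_castSucc (fun k => A _ k * A _ k), ← sq (A _ (Fin.last q))] at h
    subst hxp ha1
    exact h
  rw [hrp2, hxx, dotProduct_projection_eq_of_gram_factorization hM hy hX1X1,
    mul_div_mul_left _ _ hn0]
end

section
/- For each i with 1 ≤ i ≤ p, let P_(i) be the permutation matrix interchanging coordinates i and p (with P_(p) = I_p), let A_(i) be the Cholesky root of (1/n) (X̃ P_(i))^T (X̃ P_(i)), let B_(i)^T = A_(i)^{-1}, let b_(i) be the last column of B_(i), and let b_(i)pp be the last entry of b_(i). Then the inverse of the data covariance matrix equals the p × p matrix whose i-th column is b_(i)pp P_(i) b_(i); that is, ((1/n) X̃^T X̃)^{-1} = [b_(1)pp P_(1) b_(1), …, b_(p)pp P_(p) b_(p)]. -/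
open Matrix

/-- The permutation matrix of a transposition is symmetric. -/
theorem transpose_permMatrix_swap {ι : Type*} [DecidableEq ι] (i j : ι) :
    ((Equiv.swap i j).permMatrix ℝ)ᵀ = (Equiv.swap i j).permMatrix ℝ := by
  rw [Matrix.transpose_permMatrix, Equiv.Perm.inv_def, Equiv.symm_swap]

/-- The permutation matrix of a transposition is an involution. -/
theorem permMatrix_swap_mul_self {ι : Type*} [Fintype ι] [DecidableEq ι] (i j : ι) :
    (Equiv.swap i j).permMatrix ℝ * (Equiv.swap i j).permMatrix ℝ = 1 := by
  rw [← Matrix.permMatrix_mul, Equiv.swap_mul_self, Matrix.permMatrix_one]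

/-- The inverse of a lower triangular matrix with positive diagonal is lower triangular. -/
theorem inv_apply_eq_zero_of_lowerTriangular {ι : Type*} [Fintype ι] [LinearOrder ι]
    {A : Matrix ι ι ℝ} (hlow : ∀ j k, j < k → A j k = 0) (hdiag : ∀ j, 0 < A j j)
    {j k : ι} (hjk : j < k) : A⁻¹ j k = 0 := by
  have hA : A.IsLowerTriangular := fun j k h => hlow j k h
  have hdet : IsUnit A.det := by
    rw [Matrix.det_of_isLowerTriangular A hA]
    exact (Finset.prod_pos fun j _ => hdiag j).ne'.isUnit
  let := Matrix.invertibleOfIsUnitDet A hdet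
  exact Matrix.blockTriangular_inv_of_blockTriangular hA hjk

/-- The inverse of the data covariance matrix equals the p × p matrix whose
i-th column is `b₍ᵢ₎ₚₚ P₍ᵢ₎ b₍ᵢ₎`, where `b₍ᵢ₎` is the last column of `B₍ᵢ₎`
(with `B₍ᵢ₎ᵀ = A₍ᵢ₎⁻¹`, `A₍ᵢ₎` the Cholesky root of `(1/n)(X̃ P₍ᵢ₎)ᵀ(X̃ P₍ᵢ₎)`)
and `b₍ᵢ₎ₚₚ` its last entry. -/
theorem inverse_covariance_columns (n p : ℕ) (hn : 0 < n) (hp : 1 ≤ p)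
    (X : Matrix (Fin n) (Fin p) ℝ)
    (Xt : Matrix (Fin n) (Fin p) ℝ)
    (hXt : Xt = (1 - (n : ℝ)⁻¹ • Matrix.of (fun _ _ => (1 : ℝ))) * X)
    (hSpd : ((n : ℝ)⁻¹ • (Xtᵀ * Xt)).PosDef)
    (lastIdx : Fin p) (hlast : (lastIdx : ℕ) = p - 1)
    (P : Fin p → Matrix (Fin p) (Fin p) ℝ)
    (hP : ∀ i, P i = (Equiv.swap i lastIdx).permMatrix ℝ)
    (A B : Fin p → Matrix (Fin p) (Fin p) ℝ)
    (hAlow : ∀ i, ∀ j k : Fin p, j < k → A i j k = 0)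
    (hAdiag : ∀ i, ∀ j : Fin p, 0 < A i j j)
    (hA : ∀ i, (n : ℝ)⁻¹ • ((Xt * P i)ᵀ * (Xt * P i)) = A i * (A i)ᵀ)
    (hB : ∀ i, (B i)ᵀ = (A i)⁻¹)
    (b : Fin p → Fin p → ℝ)
    (hb : ∀ i, b i = fun k => B i k lastIdx) :
    ((n : ℝ)⁻¹ • (Xtᵀ * Xt))⁻¹ =
      Matrix.of fun j i => b i lastIdx * (P i *ᵥ b i) j := by
  ext j i
  set S := (n : ℝ)⁻¹ • (Xtᵀ * Xt) with hS
  have hsymm : (P i)ᵀ = P i := by rw [hP]; exact transpose_permMatrix_swap _ _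
  have hsq : P i * P i = 1 := by rw [hP]; exact permMatrix_swap_mul_self _ _
  have hconj : P i * S * P i = A i * (A i)ᵀ := by
    rw [← hA i, Matrix.transpose_mul, hsymm, hS]
    simp only [Matrix.mul_smul, Matrix.smul_mul, Matrix.mul_assoc]
  have hPinv : (P i)⁻¹ = P i := Matrix.inv_eq_left_inv hsq
  have hBt : B i = ((A i)ᵀ)⁻¹ := by
    rw [← Matrix.transpose_nonsing_inv, ← hB i, Matrix.transpose_transpose]
  have hinvconj : P i * S⁻¹ * P i = B i * (B i)ᵀ := by
    have h := congrArg (fun M => M⁻¹) hconj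
    simp only [Matrix.mul_inv_rev, hPinv] at h
    rw [Matrix.mul_assoc, h, hB i, hBt]
  have hSinv : S⁻¹ = P i * (B i * (B i)ᵀ) * P i := by
    rw [← hinvconj]
    calc S⁻¹ = (P i * P i) * S⁻¹ * (P i * P i) := by rw [hsq, Matrix.one_mul, Matrix.mul_one]
      _ = _ := by simp only [Matrix.mul_assoc]
  have hcol : ∀ M : Matrix (Fin p) (Fin p) ℝ, (M * P i) j i = M j lastIdx := by
    intro M
    rw [hP, Equiv.Perm.permMatrix, PEquiv.mul_toMatrix_toPEquiv]
    simp
  have hBB : ∀ k, (B i * (B i)ᵀ) k lastIdx = b i lastIdx * b i k := by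
    intro k
    rw [Matrix.mul_apply, Finset.sum_eq_single lastIdx]
    · rw [Matrix.transpose_apply, hb, mul_comm]
    · intro l _ hl
      have hlt : l < lastIdx := by
        have := l.isLt
        have : (l : ℕ) ≠ lastIdx := fun h => hl (Fin.ext h)
        exact Fin.lt_def.2 (by omega)
      rw [hB, inv_apply_eq_zero_of_lowerTriangular (hAlow i) (hAdiag i) hlt, mul_zero]
    · simp
  rw [hSinv, hcol, Matrix.mul_apply, Matrix.of_apply, Matrix.mulVec, dotProduct, Finset.mul_sum]
  refine Finset.sum_congr rfl fun k _ => ?_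
  rw [hBB k]
  ring
end

section
/- For each i with 1 ≤ i ≤ p, let P_(i) be the permutation matrix interchanging coordinates i and p, let A_(i) be the Cholesky root of (1/n)(X̃ P_(i))^T (X̃ P_(i)), let B_(i)^T = A_(i)^{-1}, and let b_(i) be the last column of B_(i). Let r_i² be the squared multiple correlation coefficient of the i-th regressor with the remaining regressors (i.e., r_i² is obtained from the regression of the i-th centered column of X on the other centered columns), s_i² = (1/n) Σ_{r=1}^n (x_ri − x̄_i)² the data variance of the i-th regressor, and x̄ the vector of column means of X. Then for every r, the squared Mahalanobis distance D_r² = n (x_r − x̄)^T (X̃^T X̃)^{-1} (x_r − x̄) satisfies D_r² = Σ_{i=1}^p (1 − r_i²)^{-1/2} [b_(i)^T P_(i) (x_r − x̄)] ((x_ri − x̄_i)/s_i). -/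
open Matrix

/-- The inverse of the Schur complement of the `i`-th principal complement is a diagonal entry
of the inverse matrix. -/
theorem Matrix.PosDef.inv_apply_mul_schur_complement {q : ℕ}
    {G : Matrix (Fin (q + 1)) (Fin (q + 1)) ℝ} (hG : G.PosDef) (i : Fin (q + 1)) :
    G⁻¹ i i * (G i i - (fun j => G i (i.succAbove j)) ⬝ᵥ
      ((G.submatrix i.succAbove i.succAbove)⁻¹ *ᵥ fun j => G (i.succAbove j) i)) = 1 := by
  set H := G.submatrix i.succAbove i.succAbove with hH
  set g : Fin q → ℝ := fun j => G (i.succAbove j) i with hg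
  set v := H⁻¹ *ᵥ g with hv
  have hHpd : H.PosDef := hG.submatrix Fin.succAbove_right_injective
  have hHv : H *ᵥ v = g := by
    rw [hv, mulVec_mulVec, mul_nonsing_inv _ ((isUnit_iff_isUnit_det _).1 hHpd.isUnit), one_mulVec]
  set c := G i i - (fun j => G i (i.succAbove j)) ⬝ᵥ v with hc
  set w : Fin (q + 1) → ℝ := i.insertNth 1 (-v) with hw
  have hGw : G *ᵥ w = Pi.single i c := by
    funext k
    refine Fin.succAboveCases i ?_ (fun j => ?_) k
    · simp [mulVec, dotProduct, Fin.sum_univ_succAbove _ i, hw, hc, sub_eq_add_neg]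
    · have h := congrFun hHv j
      simp only [mulVec, dotProduct, hH, hg, submatrix_apply] at h
      simp [mulVec, dotProduct, Fin.sum_univ_succAbove _ i, hw, h]
  have hwG : w = G⁻¹ *ᵥ Pi.single i c := by
    rw [← hGw, mulVec_mulVec, nonsing_inv_mul _ ((isUnit_iff_isUnit_det _).1 hG.isUnit), one_mulVec]
  have h := congrFun hwG i
  simpa [hw, mulVec_single] using h.symm

theorem Matrix.inv_last_row_of_eq_mul_transpose {m : Type*} [Fintype m] [LinearOrder m]
    {A M : Matrix m m ℝ} {l : m} (hl : ∀ k, k ≤ l) (hlow : ∀ j k, j < k → A j k = 0)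
    (hM : M = A * Aᵀ) (hunit : IsUnit M.det) (k : m) : A⁻¹ l k = A l l * M⁻¹ l k := by
  have hA : IsUnit A.det := by
    rw [hM, det_mul] at hunit
    exact isUnit_of_mul_isUnit_left hunit
  have h : A⁻¹ = Aᵀ * M⁻¹ := by
    rw [hM, Matrix.mul_inv_rev, ← Matrix.mul_assoc,
      mul_nonsing_inv _ (by rwa [det_transpose]), Matrix.one_mul]
  rw [h, mul_apply, Finset.sum_eq_single l]
  · rfl
  · intro j _ hj
    rw [transpose_apply, hlow j l (lt_of_le_of_ne (hl j) hj), zero_mul]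
  · simp

theorem Matrix.sq_last_mul_inv_of_eq_mul_transpose {m : Type*} [Fintype m] [LinearOrder m]
    {A M : Matrix m m ℝ} {l : m} (hl : ∀ k, k ≤ l) (hlow : ∀ j k, j < k → A j k = 0)
    (hM : M = A * Aᵀ) (hunit : IsUnit M.det) : A l l ^ 2 * M⁻¹ l l = 1 := by
  have hA : IsUnit A.det := by
    rw [hM, det_mul] at hunit
    exact isUnit_of_mul_isUnit_left hunit
  have h := congrFun (congrFun (nonsing_inv_mul A hA) l) l
  rw [mul_apply, Finset.sum_eq_single l, one_apply_eq,
    inv_last_row_of_eq_mul_transpose hl hlow hM hunit] at h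
  · linear_combination h
  · intro j _ hj
    rw [hlow j l (lt_of_le_of_ne (hl j) hj), mul_zero]
  · simp

/-- Decomposition I: The squared Mahalanobis distance
`D_r² = n (x_r - x̄)ᵀ (X̃ᵀ X̃)⁻¹ (x_r - x̄)` decomposes as
`D_r² = Σᵢ (1 - rᵢ²)^{-1/2} [b₍ᵢ₎ᵀ P₍ᵢ₎ (x_r - x̄)] ((x_{ri} - x̄ᵢ)/sᵢ)`,
where `rᵢ²` is the squared multiple correlation coefficient of the i-th regressor with the
remaining regressors, `sᵢ²` its data variance, `P₍ᵢ₎` swaps coordinates i and p, and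
`b₍ᵢ₎` is the last column of `B₍ᵢ₎` with `B₍ᵢ₎ᵀ = A₍ᵢ₎⁻¹`, `A₍ᵢ₎` the Cholesky root
of `(1/n)(X̃ P₍ᵢ₎)ᵀ(X̃ P₍ᵢ₎)`. -/
theorem mahalanobis_decomposition_I (n p : ℕ) (hn : 0 < n) (hp : 1 ≤ p)
    (X : Matrix (Fin n) (Fin p) ℝ)
    (Xt : Matrix (Fin n) (Fin p) ℝ)
    (hXt : Xt = (1 - (n : ℝ)⁻¹ • Matrix.of (fun _ _ => (1 : ℝ))) * X)
    (hSpd : ((n : ℝ)⁻¹ • (Xtᵀ * Xt)).PosDef)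
    (xbar : Fin p → ℝ) (hxbar : xbar = fun j => (n : ℝ)⁻¹ * ∑ i, X i j)
    (lastIdx : Fin p) (hlast : (lastIdx : ℕ) = p - 1)
    (P : Fin p → Matrix (Fin p) (Fin p) ℝ)
    (hP : ∀ i, P i = (Equiv.swap i lastIdx).permMatrix ℝ)
    (A B : Fin p → Matrix (Fin p) (Fin p) ℝ)
    (hAlow : ∀ i, ∀ j k : Fin p, j < k → A i j k = 0)
    (hAdiag : ∀ i, ∀ j : Fin p, 0 < A i j j)
    (hA : ∀ i, (n : ℝ)⁻¹ • ((Xt * P i)ᵀ * (Xt * P i)) = A i * (A i)ᵀ)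
    (hB : ∀ i, (B i)ᵀ = (A i)⁻¹)
    (b : Fin p → Fin p → ℝ)
    (hb : ∀ i, b i = fun k => B i k lastIdx)
    -- `sk i` enumerates the indices of the regressors other than the i-th one
    (sk : Fin p → Fin (p - 1) → Fin p)
    (hsk : ∀ i j, (sk i j : ℕ) = if (j : ℕ) < (i : ℕ) then (j : ℕ) else (j : ℕ) + 1)
    -- squared multiple correlation coefficient of the i-th regressor with the rest
    (ri2 : Fin p → ℝ)
    (hri2 : ∀ i, ri2 i =
      ((fun r => Xt r i) ⬝ᵥ ((Xt.submatrix id (sk i)) *ᵥ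
          (((Xt.submatrix id (sk i))ᵀ * (Xt.submatrix id (sk i)))⁻¹ *ᵥ
            ((Xt.submatrix id (sk i))ᵀ *ᵥ (fun r => Xt r i))))) /
        ((fun r => Xt r i) ⬝ᵥ (fun r => Xt r i)))
    -- standard deviation of the i-th regressor
    (s : Fin p → ℝ)
    (hs : ∀ i, s i = Real.sqrt ((n : ℝ)⁻¹ * ∑ r, (X r i - xbar i) ^ 2))
    (r : Fin n) :
    (n : ℝ) * ((fun j => X r j - xbar j) ⬝ᵥ ((Xtᵀ * Xt)⁻¹ *ᵥ (fun j => X r j - xbar j))) =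
      ∑ i : Fin p, (1 - ri2 i) ^ (-(1 : ℝ) / 2) *
        (b i ⬝ᵥ (P i *ᵥ (fun j => X r j - xbar j))) * ((X r i - xbar i) / s i) := by
  obtain ⟨q, rfl⟩ : ∃ q, p = q + 1 := ⟨p - 1, by omega⟩
  have hn0 : (n : ℝ) ≠ 0 := by positivity
  have hsk' : ∀ i, sk i = i.succAbove := by
    intro i
    funext j
    ext
    rw [hsk, Fin.succAbove]
    simp only [Fin.lt_def, Fin.val_castSucc]
    split_ifs <;> simp
  have hl : ∀ k, k ≤ lastIdx := fun k => by
    rw [Fin.le_def]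
    omega
  have hXta : ∀ t j, Xt t j = X t j - xbar j := by
    intro t j
    have hXt' : Xt = ((1 - (n : ℝ)⁻¹ • Matrix.of (fun _ _ => (1 : ℝ)) :
        Matrix (Fin n) (Fin n) ℝ) * X : Matrix (Fin n) (Fin (q + 1)) ℝ) := hXt
    rw [hXt', Matrix.sub_mul, Matrix.one_mul, Matrix.sub_apply, hxbar]
    simp [mul_apply, Finset.mul_sum]
  set S := (n : ℝ)⁻¹ • (Xtᵀ * Xt) with hS
  have hG : Xtᵀ * Xt = (n : ℝ) • S := by rw [hS, smul_smul, mul_inv_cancel₀ hn0, one_smul]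
  have hGpd : (Xtᵀ * Xt).PosDef := by
    rw [hG]
    exact hSpd.smul (by positivity)
  have hSu : IsUnit S.det := (isUnit_iff_isUnit_det _).1 hSpd.isUnit
  have hSinv : (n : ℝ) • (Xtᵀ * Xt)⁻¹ = S⁻¹ := by
    symm
    apply inv_eq_left_inv
    rw [hS, Matrix.smul_mul, Matrix.mul_smul, smul_smul, mul_inv_cancel₀ hn0, one_smul,
      nonsing_inv_mul _ ((isUnit_iff_isUnit_det _).1 hGpd.isUnit)]
  set y : Fin (q + 1) → ℝ := fun j => X r j - xbar j
  rw [← smul_eq_mul, ← dotProduct_smul, ← smul_mulVec, hSinv, dotProduct]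
  refine Finset.sum_congr rfl fun i _ => ?_
  set σ := Equiv.swap i lastIdx
  have hσl : σ lastIdx = i := Equiv.swap_apply_right _ _
  have hM : S.submatrix σ σ = A i * (A i)ᵀ := by
    rw [← hA i]
    have hXP : Xt * P i = Xt.submatrix id σ := by
      rw [hP, PEquiv.mul_toMatrix_toPEquiv, Equiv.symm_swap]
    rw [hXP]
    rfl
  have hMinv : (S.submatrix σ σ)⁻¹ = S⁻¹.submatrix σ σ := inv_submatrix_equiv S σ σ
  have hMu : IsUnit (S.submatrix σ σ).det := by rwa [det_submatrix_equiv_self]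
  have hrow := inv_last_row_of_eq_mul_transpose hl (hAlow i) hM hMu
  have hsq := sq_last_mul_inv_of_eq_mul_transpose hl (hAlow i) hM hMu
  rw [hMinv, submatrix_apply, hσl] at hsq
  have hbP : b i ⬝ᵥ (P i *ᵥ y) = A i lastIdx lastIdx * (S⁻¹ *ᵥ y) i := by
    have hPy : P i *ᵥ y = y ∘ σ := by
      rw [hP, permMatrix_mulVec]
    have hbi : b i = fun k => A i lastIdx lastIdx * S⁻¹ i (σ k) := by
      funext k
      rw [hb]
      change (B i)ᵀ lastIdx k = _
      rw [hB, hrow, hMinv, submatrix_apply, hσl]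
    rw [hPy, hbi, mulVec, dotProduct, dotProduct, Finset.mul_sum,
      ← Equiv.sum_comp σ fun k => A i lastIdx lastIdx * (S⁻¹ i k * y k)]
    simp [mul_assoc]
  have hGii : 0 < (Xtᵀ * Xt) i i := hGpd.diag_pos
  set a := A i lastIdx lastIdx
  have hapos : 0 < a := hAdiag i lastIdx
  have hsi : s i ^ 2 = (n : ℝ)⁻¹ * (Xtᵀ * Xt) i i := by
    have : ∑ t, (X t i - xbar i) ^ 2 = (Xtᵀ * Xt) i i := by
      simp [mul_apply, hXta, sq]
    rw [hs, this, Real.sq_sqrt (by positivity)]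
  have hspos : 0 < s i := by
    refine lt_of_le_of_ne (hs i ▸ Real.sqrt_nonneg _) fun h => ?_
    rw [← h] at hsi
    have : 0 < (n : ℝ)⁻¹ * (Xtᵀ * Xt) i i := by positivity
    simp [← hsi] at this
  have hschur := hGpd.inv_apply_mul_schur_complement i
  have hri : ri2 i * (Xtᵀ * Xt) i i = (fun j => (Xtᵀ * Xt) i (i.succAbove j)) ⬝ᵥ
      (((Xtᵀ * Xt).submatrix i.succAbove i.succAbove)⁻¹ *ᵥ
        fun j => (Xtᵀ * Xt) (i.succAbove j) i) := by
    have h1 : (fun t => Xt t i) ⬝ᵥ (fun t => Xt t i) = (Xtᵀ * Xt) i i := rfl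
    rw [hri2, h1, div_mul_cancel₀ _ hGii.ne', hsk', dotProduct_mulVec]
    rfl
  rw [← hri] at hschur
  have hSii : S⁻¹ i i = n * (Xtᵀ * Xt)⁻¹ i i := by rw [← hSinv]; rfl
  have hratio : 1 - ri2 i = (a / s i) ^ 2 := by
    have hinv : (Xtᵀ * Xt)⁻¹ i i ≠ 0 := left_ne_zero_of_mul_eq_one hschur
    rw [div_pow, hsi, eq_div_iff (by positivity)]
    rw [hSii] at hsq
    refine mul_left_cancel₀ (mul_ne_zero hn0 hinv) ?_
    have hnn : (n : ℝ) * (n : ℝ)⁻¹ = 1 := mul_inv_cancel₀ hn0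
    linear_combination hschur - hsq + (1 - ri2 i) * (Xtᵀ * Xt)⁻¹ i i * (Xtᵀ * Xt) i i * hnn
  have hpow : (1 - ri2 i) ^ (-(1 : ℝ) / 2) = s i / a := by
    rw [hratio, ← Real.rpow_natCast, ← Real.rpow_mul (by positivity)]
    norm_num [Real.rpow_neg_one]
  rw [hpow, hbP]
  change y i * _ = _ * (y i / s i)
  field_simp
end

section
/- Let b be the last column of B, let x_{r(−p)} and x̄_{(−p)} be the vectors of the first p−1 entries of x_r and x̄ respectively, and let A_1 be the leading principal (p−1) × (p−1) submatrix of A, so that A_1 A_1^T is the data covariance matrix of the first p−1 regressors. Then the squared Mahalanobis distance D_r² = n (x_r − x̄)^T (X̃^T X̃)^{-1} (x_r − x̄) satisfies the decomposition D_r² = D_{r(−p)}² + [b^T (x_r − x̄)]², where D_{r(−p)}² = (x_{r(−p)} − x̄_{(−p)})^T (A_1 A_1^T)^{-1} (x_{r(−p)} − x̄_{(−p)}) is the squared Mahalanobis distance based on the first p−1 regressors. -/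
open Matrix

namespace Matrix

/-- The quadratic form of `(L Lᵀ)⁻¹` at `L z` is the squared Euclidean length of `z`. -/
theorem mulVec_dotProduct_mul_transpose_inv_mulVec {ι R : Type*} [Fintype ι] [DecidableEq ι]
    [CommRing R] (L : Matrix ι ι R) (hL : IsUnit L.det) (z : ι → R) :
    (L *ᵥ z) ⬝ᵥ ((L * Lᵀ)⁻¹ *ᵥ (L *ᵥ z)) = z ⬝ᵥ z := by
  rw [mul_inv_rev, mulVec_mulVec, Matrix.mul_assoc, nonsing_inv_mul L hL, Matrix.mul_one,
    ← transpose_nonsing_inv, dotProduct_mulVec, vecMul_transpose, mulVec_mulVec,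
    nonsing_inv_mul L hL, one_mulVec]

/-- The determinant of a lower triangular matrix with positive diagonal is a unit. -/
theorem isUnit_det_of_lower_triangular {m : ℕ} (L : Matrix (Fin m) (Fin m) ℝ)
    (hlow : ∀ i j, i < j → L i j = 0) (hdiag : ∀ i, 0 < L i i) : IsUnit L.det := by
  rw [det_of_isLowerTriangular L fun i j h => hlow i j h, isUnit_iff_ne_zero]
  exact Finset.prod_ne_zero_iff.2 fun i _ => (hdiag i).ne'

/-- Splitting off the last coordinate in the quadratic form of the inverse of `L Lᵀ`, for `L` lower
triangular. -/
theorem dotProduct_mul_transpose_inv_mulVec_eq_castSucc_add_sq {m : ℕ}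
    (L : Matrix (Fin (m + 1)) (Fin (m + 1)) ℝ)
    (hlow : ∀ i j, i < j → L i j = 0) (hdiag : ∀ i, 0 < L i i) (d : Fin (m + 1) → ℝ) :
    d ⬝ᵥ ((L * Lᵀ)⁻¹ *ᵥ d) =
      (d ∘ Fin.castSucc) ⬝ᵥ ((L.submatrix Fin.castSucc Fin.castSucc *
        (L.submatrix Fin.castSucc Fin.castSucc)ᵀ)⁻¹ *ᵥ (d ∘ Fin.castSucc)) +
        ((L⁻¹ *ᵥ d) (Fin.last m)) ^ 2 := by
  have hL := isUnit_det_of_lower_triangular L hlow hdiag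
  have hL₁ := isUnit_det_of_lower_triangular (L.submatrix Fin.castSucc Fin.castSucc)
    (fun i j h => hlow _ _ (by simpa using h)) (fun i => hdiag _)
  obtain ⟨z, rfl⟩ : ∃ z, L *ᵥ z = d :=
    ⟨L⁻¹ *ᵥ d, by rw [mulVec_mulVec, mul_nonsing_inv L hL, one_mulVec]⟩
  have hz : (L *ᵥ z) ∘ Fin.castSucc =
      L.submatrix Fin.castSucc Fin.castSucc *ᵥ (z ∘ Fin.castSucc) := by
    ext i
    simp [mulVec, dotProduct, Fin.sum_univ_castSucc, hlow _ _ (Fin.castSucc_lt_last i)]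
  rw [hz, mulVec_dotProduct_mul_transpose_inv_mulVec _ hL₁,
    mulVec_dotProduct_mul_transpose_inv_mulVec _ hL, mulVec_mulVec, nonsing_inv_mul L hL,
    one_mulVec]
  simp [dotProduct, Fin.sum_univ_castSucc, sq]

end Matrix

/-- Decomposition II: The squared Mahalanobis distance
`D_r² = n (x_r - x̄)ᵀ (X̃ᵀ X̃)⁻¹ (x_r - x̄)` satisfies
`D_r² = D_{r(-p)}² + [bᵀ (x_r - x̄)]²`, where
`D_{r(-p)}² = (x_{r(-p)} - x̄_{(-p)})ᵀ (A₁ A₁ᵀ)⁻¹ (x_{r(-p)} - x̄_{(-p)})` is the squared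
Mahalanobis distance based on the first p-1 regressors and `b` is the last column of `B`. -/
theorem mahalanobis_decomposition_II (n p : ℕ) (hn : 0 < n) (hp : 2 ≤ p)
    (X : Matrix (Fin n) (Fin p) ℝ)
    (Xt : Matrix (Fin n) (Fin p) ℝ)
    (hXt : Xt = (1 - (n : ℝ)⁻¹ • Matrix.of (fun _ _ => (1 : ℝ))) * X)
    (hSpd : ((n : ℝ)⁻¹ • (Xtᵀ * Xt)).PosDef)
    (A : Matrix (Fin p) (Fin p) ℝ)
    (hAlow : ∀ i j : Fin p, i < j → A i j = 0)
    (hAdiag : ∀ i, 0 < A i i)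
    (hA : (n : ℝ)⁻¹ • (Xtᵀ * Xt) = A * Aᵀ)
    (B : Matrix (Fin p) (Fin p) ℝ)
    (hB : Bᵀ = A⁻¹)
    (lastIdx : Fin p) (hlast : (lastIdx : ℕ) = p - 1)
    (xbar : Fin p → ℝ) (hxbar : xbar = fun j => (n : ℝ)⁻¹ * ∑ i, X i j)
    (b : Fin p → ℝ) (hb : b = fun k => B k lastIdx)
    (A1 : Matrix (Fin (p - 1)) (Fin (p - 1)) ℝ)
    (hA1 : A1 = A.submatrix (Fin.castLE (Nat.sub_le p 1)) (Fin.castLE (Nat.sub_le p 1)))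
    (r : Fin n) :
    (n : ℝ) * ((fun j => X r j - xbar j) ⬝ᵥ ((Xtᵀ * Xt)⁻¹ *ᵥ (fun j => X r j - xbar j))) =
      ((fun j : Fin (p - 1) => X r (Fin.castLE (Nat.sub_le p 1) j) - xbar (Fin.castLE (Nat.sub_le p 1) j)) ⬝ᵥ
          ((A1 * A1ᵀ)⁻¹ *ᵥ
            (fun j : Fin (p - 1) => X r (Fin.castLE (Nat.sub_le p 1) j) - xbar (Fin.castLE (Nat.sub_le p 1) j)))) +
        (b ⬝ᵥ (fun j => X r j - xbar j)) ^ 2 := by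
  obtain ⟨m, rfl⟩ : ∃ m, p = m + 1 := ⟨p - 1, by omega⟩
  obtain rfl : lastIdx = Fin.last m := Fin.ext (by simpa using hlast)
  have hn0 : (n : ℝ) ≠ 0 := by positivity
  have hAdet := isUnit_det_of_lower_triangular A hAlow hAdiag
  have hdet : IsUnit (A * Aᵀ).det := by
    rw [det_mul, det_transpose]
    exact hAdet.mul hAdet
  have hinv : (n : ℝ) • (Xtᵀ * Xt)⁻¹ = (A * Aᵀ)⁻¹ := by
    have hXX : Xtᵀ * Xt = (n : ℝ) • (A * Aᵀ) := by rw [← hA, smul_inv_smul₀ hn0]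
    have : (Xtᵀ * Xt)⁻¹ = (n : ℝ)⁻¹ • (A * Aᵀ)⁻¹ := by
      apply inv_eq_right_inv
      rw [hXX, smul_mul_smul_comm, mul_inv_cancel₀ hn0, mul_nonsing_inv _ hdet, one_smul]
    rw [this, smul_inv_smul₀ hn0]
  have hbd : b ⬝ᵥ (fun j => X r j - xbar j) =
      (A⁻¹ *ᵥ fun j => X r j - xbar j) (Fin.last m) := by
    rw [hb, ← hB]
    rfl
  rw [← smul_eq_mul, ← dotProduct_smul, ← smul_mulVec, hinv, hbd, hA1]
  exact dotProduct_mul_transpose_inv_mulVec_eq_castSucc_add_sq A hAlow hAdiag _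
end

section
/- Let X_1 consist of the first p−1 columns of X, let h_rr be the r-th leverage for the model with all p regressors (the r-th diagonal element of Z(Z^TZ)^{-1}Z^T with Z = (1_n X)), and let h_rr^{(−p)} be the r-th leverage for the model with the p-th regressor removed (the r-th diagonal element of Z_1(Z_1^TZ_1)^{-1}Z_1^T with Z_1 = (1_n X_1)), assuming both Z^TZ and Z_1^TZ_1 are invertible. Then h_rr − h_rr^{(−p)} = (1/n) [b^T (x_r − x̄)]², where b is the last column of B. -/
open Matrix

/-- The orthogonal projection onto the column space of `Z` is characterised by being symmetric,
fixing `Z`, and having its columns in the column space of `Z`. -/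
lemma hat_eq_of_isSymm {m k : Type*} [Fintype m] [Fintype k] [DecidableEq k]
    {Z : Matrix m k ℝ} (hZ : IsUnit (Zᵀ * Z).det) {P : Matrix m m ℝ} (hP : Pᵀ = P)
    (hPZ : P * Z = Z) (hcol : ∃ W : Matrix k m ℝ, P = Z * W) :
    Z * (Zᵀ * Z)⁻¹ * Zᵀ = P := by
  obtain ⟨W, hW⟩ := hcol
  have hZP : Zᵀ * P = Zᵀ := by
    simpa [Matrix.transpose_mul, hP] using congrArg Matrix.transpose hPZ
  calc Z * (Zᵀ * Z)⁻¹ * Zᵀ = Z * (Zᵀ * Z)⁻¹ * (Zᵀ * P) := by rw [hZP]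
    _ = Z * ((Zᵀ * Z)⁻¹ * (Zᵀ * Z)) * W := by rw [hW]; simp only [Matrix.mul_assoc]
    _ = P := by rw [Matrix.nonsing_inv_mul _ hZ, Matrix.mul_one, hW]

/-- Gram–Schmidt update of the projection onto a column space when one column is appended. -/
lemma hat_append_column {m k l : Type*} [Fintype m] [Fintype k] [DecidableEq k]
    [Fintype l] [DecidableEq l] {Z : Matrix m k ℝ} {Z₁ : Matrix m l ℝ}
    (hZ : IsUnit (Zᵀ * Z).det) (hZ₁ : IsUnit (Z₁ᵀ * Z₁).det) (f : l → k) (j₀ : k)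
    (hf : ∀ i j, Z₁ i j = Z i (f j)) (hcover : ∀ j, j = j₀ ∨ ∃ i, f i = j)
    {v : m → ℝ} (d : l → ℝ) (c : ℝ) (hv : v = Z₁ *ᵥ d + c • Z.col j₀)
    (hv0 : v ⬝ᵥ v ≠ 0) (horth : v ᵥ* Z₁ = 0) :
    Z * (Zᵀ * Z)⁻¹ * Zᵀ =
      Z₁ * (Z₁ᵀ * Z₁)⁻¹ * Z₁ᵀ + (v ⬝ᵥ v)⁻¹ • vecMulVec v v := by
  set H := Z₁ * (Z₁ᵀ * Z₁)⁻¹ * Z₁ᵀ with hH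
  have hHZ : H * Z₁ = Z₁ := by
    rw [hH, Matrix.mul_assoc, Matrix.mul_assoc, Matrix.nonsing_inv_mul _ hZ₁, Matrix.mul_one]
  have hHT : Hᵀ = H := by
    simp [hH, Matrix.transpose_mul, Matrix.transpose_nonsing_inv, Matrix.mul_assoc]
  have hHv : H *ᵥ v = 0 := by
    rw [hH, ← Matrix.mulVec_mulVec, Matrix.mulVec_transpose, horth, Matrix.mulVec_zero]
  have hvv : v ⬝ᵥ v = c * (v ⬝ᵥ Z.col j₀) := by
    calc v ⬝ᵥ v = v ⬝ᵥ (Z₁ *ᵥ d + c • Z.col j₀) := congrArg (v ⬝ᵥ ·) hv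
      _ = c * (v ⬝ᵥ Z.col j₀) := by
        rw [dotProduct_add, dotProduct_mulVec, horth, zero_dotProduct, dotProduct_smul, zero_add,
          smul_eq_mul]
  have hc : c ≠ 0 := by
    rintro rfl
    simp [hvv] at hv0
  have hHz : Z₁ *ᵥ d + c • (H *ᵥ Z.col j₀) = 0 := by
    rw [← hHv]
    conv_rhs => rw [hv]
    rw [Matrix.mulVec_add, Matrix.mulVec_mulVec, hHZ, Matrix.mulVec_smul]
  apply hat_eq_of_isSymm hZ
  · simp [hHT, Matrix.transpose_add, transpose_vecMulVec]
  · ext i j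
    rw [Matrix.add_mul, Matrix.smul_mul, Matrix.vecMulVec_mul]
    rcases hcover j with rfl | ⟨a, rfl⟩
    · have h1 := congrFun hHz i
      have h2 := congrFun hv i
      have h3 : (v ᵥ* Z) j = v ⬝ᵥ Z.col j := rfl
      have h4 : (H * Z) i j = (H *ᵥ Z.col j) i := rfl
      simp only [Matrix.add_apply, Matrix.smul_apply, vecMulVec_apply, h3, h4, smul_eq_mul,
        Pi.add_apply, Pi.smul_apply, Pi.zero_apply, Matrix.col_apply] at *
      have hne : v ⬝ᵥ Z.col j ≠ 0 := by
        intro h; simp [hvv, h] at hv0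
      rw [hvv]
      field_simp
      linarith
    · have h1 : (H * Z) i (f a) = Z i (f a) := by
        rw [← hf, ← congrFun (congrFun hHZ i) a]
        simp [Matrix.mul_apply, hf]
      have h2 : (v ᵥ* Z) (f a) = 0 := by
        simpa [Matrix.vecMul, dotProduct, hf] using congrFun horth a
      simp [h1, h2, vecMulVec_apply]
  · have hZE : Z₁ = Z * (1 : Matrix k k ℝ).submatrix id f := by
      ext i j
      simp [Matrix.mul_apply, hf, Matrix.one_apply]
    have hvZ : v = Z *ᵥ ((1 : Matrix k k ℝ).submatrix id f *ᵥ d + c • Pi.single j₀ 1) := by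
      rw [Matrix.mulVec_add, Matrix.mulVec_mulVec, ← hZE, Matrix.mulVec_smul,
        Matrix.mulVec_single_one, hv]
    set e := (1 : Matrix k k ℝ).submatrix id f *ᵥ d + c • Pi.single j₀ 1
    refine ⟨(1 : Matrix k k ℝ).submatrix id f * ((Z₁ᵀ * Z₁)⁻¹ * Z₁ᵀ) +
      (v ⬝ᵥ v)⁻¹ • vecMulVec e v, ?_⟩
    rw [Matrix.mul_add, ← Matrix.mul_assoc, ← hZE, Matrix.mul_smul, Matrix.mul_vecMulVec, ← hvZ,
      hH, Matrix.mul_assoc]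

/-- The hat matrix of a regression with intercept, compared with the one where the last regressor
is left out, in terms of the last row of the inverse of a lower triangular root `A` of the
covariance matrix. -/
lemma hat_remove_last {n m : ℕ} (hn : 0 < n) (X Xt : Matrix (Fin n) (Fin (m + 1)) ℝ)
    (xbar : Fin (m + 1) → ℝ) (hxbar : xbar = fun j => (n : ℝ)⁻¹ * ∑ i, X i j)
    (hXt : ∀ i j, Xt i j = X i j - xbar j)
    (A : Matrix (Fin (m + 1)) (Fin (m + 1)) ℝ) (hAunit : IsUnit A.det)
    (hAlow : ∀ i j, i < j → A i j = 0)
    (hA : (n : ℝ)⁻¹ • (Xtᵀ * Xt) = A * Aᵀ)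
    (b : Fin (m + 1) → ℝ) (hb : b = A⁻¹.row (Fin.last m))
    (Z : Matrix (Fin n) (Fin (m + 2)) ℝ)
    (hZ : Z = Matrix.of fun i j => Fin.cases (motive := fun _ => ℝ) 1 (fun k => X i k) j)
    (Z₁ : Matrix (Fin n) (Fin (m + 1)) ℝ)
    (hZ₁ : Z₁ = Matrix.of fun i j =>
      Fin.cases (motive := fun _ => ℝ) 1 (fun k : Fin m => X i k.castSucc) j)
    (hZZ : IsUnit (Zᵀ * Z).det) (hZZ₁ : IsUnit (Z₁ᵀ * Z₁).det) :
    Z * (Zᵀ * Z)⁻¹ * Zᵀ = Z₁ * (Z₁ᵀ * Z₁)⁻¹ * Z₁ᵀ +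
      (n : ℝ)⁻¹ • vecMulVec (Xt *ᵥ b) (Xt *ᵥ b) := by
  have hn' : (n : ℝ) ≠ 0 := by positivity
  have hgram : Xtᵀ * Xt = (n : ℝ) • (A * Aᵀ) := by
    rw [← hA, smul_smul, mul_inv_cancel₀ hn', one_smul]
  have hbA : b ᵥ* A = Pi.single (Fin.last m) 1 := by
    have h : b = Pi.single (Fin.last m) 1 ᵥ* A⁻¹ := by
      rw [hb, Matrix.single_one_vecMul]
    rw [h, Matrix.vecMul_vecMul, Matrix.nonsing_inv_mul _ hAunit, Matrix.vecMul_one]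
  have hvXt : (Xt *ᵥ b) ᵥ* Xt = (n : ℝ) • A.col (Fin.last m) := by
    rw [← Matrix.vecMul_transpose, Matrix.vecMul_vecMul, hgram, Matrix.vecMul_smul,
      ← Matrix.vecMul_vecMul, hbA, Matrix.single_one_vecMul]
    rfl
  have hvv : (Xt *ᵥ b) ⬝ᵥ (Xt *ᵥ b) = n := by
    rw [dotProduct_mulVec, hvXt, smul_dotProduct, dotProduct_comm]
    have := congrFun hbA (Fin.last m)
    rw [Pi.single_eq_same] at this
    change (n : ℝ) • ((b ᵥ* A) (Fin.last m)) = n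
    rw [this]; simp
  have hsum : ∀ j, ∑ i, Xt i j = 0 := by
    intro j
    simp [hXt, hxbar, Finset.sum_sub_distrib]
    field_simp
    ring
  have hvsum : ∑ i, (Xt *ᵥ b) i = 0 := by
    simp only [Matrix.mulVec, dotProduct]
    rw [Finset.sum_comm]
    simp [← Finset.sum_mul, hsum]
  rw [← hvv]
  apply hat_append_column hZZ hZZ₁ Fin.castSucc (Fin.last (m + 1)) _ _
    (Fin.cons (-∑ k, b k * xbar k) (fun k => b k.castSucc)) (b (Fin.last m)) _
    (by rw [hvv]; exact hn')
  · ext j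
    refine Fin.cases ?_ (fun k => ?_) j
    · simpa [Matrix.vecMul, dotProduct, hZ₁] using hvsum
    · have h := congrFun hvXt k.castSucc
      have h0 : A k.castSucc (Fin.last m) = 0 := hAlow _ _ (Fin.castSucc_lt_last k)
      have h' : ∑ i, (Xt *ᵥ b) i * Xt i k.castSucc = 0 := by
        simpa [Matrix.vecMul, dotProduct, h0] using h
      simp only [hXt _ k.castSucc, mul_sub, Finset.sum_sub_distrib, ← Finset.sum_mul, hvsum,
        zero_mul, sub_zero] at h'
      simpa [Matrix.vecMul, dotProduct, hZ₁] using h'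
  · intro i j
    refine Fin.cases ?_ (fun k => ?_) j
    · simp [hZ, hZ₁]
    · simp [hZ, hZ₁]
  · intro j
    refine Fin.lastCases (Or.inl rfl) (fun k => Or.inr ⟨k, rfl⟩) j
  · ext i
    have h1 : (Z₁ *ᵥ Fin.cons (-∑ k, b k * xbar k) (fun k => b k.castSucc)) i =
        -∑ k, b k * xbar k + ∑ k : Fin m, X i k.castSucc * b k.castSucc := by
      simp [Matrix.mulVec, dotProduct, hZ₁, Fin.sum_univ_succ (n := m)]
    have h2 : Z i (Fin.last (m + 1)) = X i (Fin.last m) := by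
      simp [hZ, ← Fin.succ_last]
    rw [Pi.add_apply, h1, Pi.smul_apply, Matrix.col_apply, h2]
    simp only [Matrix.mulVec, dotProduct, hXt, sub_mul, Finset.sum_sub_distrib, smul_eq_mul]
    rw [Fin.sum_univ_castSucc (fun k => X i k * b k)]
    simp only [mul_comm (xbar _)]
    ring

/-- Multiplying by the centering matrix subtracts the column means. -/
lemma centering_apply {m k : Type*} [Fintype m] [DecidableEq m] (J : Matrix m m ℝ)
    (hJ : ∀ i j, J i j = 1) (X : Matrix m k ℝ) {c : ℝ} (i : m) (j : k) :
    ((1 - c • J) * X : Matrix m k ℝ) i j = X i j - c * ∑ a, X a j := by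
  rw [Matrix.sub_mul, Matrix.one_mul, Matrix.smul_mul]
  simp [Matrix.mul_apply, hJ]

/-- Removing the p-th regressor decreases the r-th leverage by
`(1/n) [bᵀ (x_r - x̄)]²`: with `Z = (1ₙ X)` and `Z₁ = (1ₙ X₁)` where `X₁` consists of the
first p-1 columns of X, `h_rr - h_rr^{(-p)} = (1/n) [bᵀ (x_r - x̄)]²`, where `b` is the
last column of `B`. -/
theorem leverage_drop_on_removing_last_regressor (n p : ℕ) (hn : 0 < n) (hp : 2 ≤ p)
    (X : Matrix (Fin n) (Fin p) ℝ)
    (Xt : Matrix (Fin n) (Fin p) ℝ)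
    (hXt : Xt = (1 - (n : ℝ)⁻¹ • Matrix.of (fun _ _ => (1 : ℝ))) * X)
    (hSpd : ((n : ℝ)⁻¹ • (Xtᵀ * Xt)).PosDef)
    (A : Matrix (Fin p) (Fin p) ℝ)
    (hAlow : ∀ i j : Fin p, i < j → A i j = 0)
    (hAdiag : ∀ i, 0 < A i i)
    (hA : (n : ℝ)⁻¹ • (Xtᵀ * Xt) = A * Aᵀ)
    (B : Matrix (Fin p) (Fin p) ℝ)
    (hB : Bᵀ = A⁻¹)
    (lastIdx : Fin p) (hlast : (lastIdx : ℕ) = p - 1)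
    (xbar : Fin p → ℝ) (hxbar : xbar = fun j => (n : ℝ)⁻¹ * ∑ i, X i j)
    (b : Fin p → ℝ) (hb : b = fun k => B k lastIdx)
    (X1 : Matrix (Fin n) (Fin (p - 1)) ℝ)
    (hX1 : X1 = X.submatrix id (Fin.castLE (Nat.sub_le p 1)))
    (Z : Matrix (Fin n) (Fin (p + 1)) ℝ)
    (hZ : Z = Matrix.of fun i j => Fin.cases (motive := fun _ => ℝ) 1 (fun k => X i k) j)
    (Z1 : Matrix (Fin n) (Fin (p - 1 + 1)) ℝ)
    (hZ1 : Z1 = Matrix.of fun i j => Fin.cases (motive := fun _ => ℝ) 1 (fun k => X1 i k) j)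
    (hZZ : IsUnit (Zᵀ * Z).det)
    (hZZ1 : IsUnit (Z1ᵀ * Z1).det)
    (r : Fin n) :
    (Z * (Zᵀ * Z)⁻¹ * Zᵀ) r r - (Z1 * (Z1ᵀ * Z1)⁻¹ * Z1ᵀ) r r =
      (n : ℝ)⁻¹ * (b ⬝ᵥ (fun j => X r j - xbar j)) ^ 2 := by
  obtain ⟨m, rfl⟩ : ∃ m, p = m + 1 := ⟨p - 1, by omega⟩
  obtain rfl : lastIdx = Fin.last m := Fin.ext (by simpa using hlast)
  have hXt' : ∀ i j, Xt i j = X i j - xbar j := by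
    intro i j
    rw [hXt, hxbar]
    exact centering_apply _ (fun _ _ => rfl) X i j
  have hAunit : IsUnit A.det := by
    have h := hSpd.det_pos
    rw [hA, Matrix.det_mul] at h
    exact isUnit_iff_ne_zero.mpr (left_ne_zero_of_mul h.ne')
  have hb' : b = A⁻¹.row (Fin.last m) := by
    rw [hb, ← hB]
    rfl
  have hZ1' : Z1 = Matrix.of fun i j =>
      Fin.cases (motive := fun _ => ℝ) 1 (fun k : Fin m => X i k.castSucc) j := by
    rw [hZ1, hX1]
    rfl
  have key := hat_remove_last hn X Xt xbar hxbar hXt' A hAunit hAlow hA b hb' Z hZ Z1 hZ1' hZZ hZZ1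
  have hv : (Xt *ᵥ b) r = b ⬝ᵥ (fun j => X r j - xbar j) := by
    rw [dotProduct_comm]
    simp only [Matrix.mulVec, dotProduct, hXt']
  have hr := congrFun (congrFun key r) r
  rw [Matrix.add_apply, Matrix.smul_apply, vecMulVec_apply, hv, smul_eq_mul] at hr
  rw [pow_two, sub_eq_iff_eq_add']
  exact hr
end
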